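/- arXiv:2605.13442 — 2 statements merged into one kernel-verified Lean document; each statement's English description precedes it below -/
import Mathlib

section
/- Let Ω₀ ⊆ ℝⁿ be compact and μ₀ a Borel probability measure on ℝⁿ with support contained in Ω₀. Let ζ be a discrete invertible flow on ℝⁿ such that every ζ t is Lipschitz with constant at most 1, and assume there is a compact set K ⊆ ℝⁿ with ζ t '' Ω₀ ⊆ K for all t ∈ ℕ. Let y : ℕ → ℝⁿ be a trajectory with (ζ t)⁻¹ (y t) ∈ Ω₀ for all t. If y is ergodic with respect to μ₀ in the backward (invertible-flow) sense, then y is ergodic in the forward (general) sense with respect to the time-varying measures μ_t := (ζ t)_* μ₀. (Forward implication of Proposition 1.) -/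
open MeasureTheory Filter Topology

/-- The error of the empirical average of `f` along the first `T` points of `x`, as an approximation
of the integral of `f`. -/
noncomputable def empiricalError {X : Type*} [MeasurableSpace X] (μ : Measure X) (x : ℕ → X)
    (T : ℕ) (f : X → ℝ) : ℝ :=
  (1 / (T : ℝ)) * ∑ t ∈ Finset.range T, f (x t) - ∫ ω, f ω ∂μ

section EmpiricalError

variable {X : Type*} [MeasurableSpace X] {μ : Measure X} {x : ℕ → X}

lemma empiricalError_sub {f g : X → ℝ} (hf : Integrable f μ) (hg : Integrable g μ) (T : ℕ) :
    empiricalError μ x T (fun z => f z - g z) =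
      empiricalError μ x T f - empiricalError μ x T g := by
  simp only [empiricalError, integral_sub hf hg, Finset.sum_sub_distrib]
  ring

lemma empiricalError_sum_mul {ι : Type*} (s : Finset ι) (a : ι → ℝ) {ρ : ι → X → ℝ}
    (hρ : ∀ i, Integrable (ρ i) μ) (T : ℕ) :
    empiricalError μ x T (fun z => ∑ i ∈ s, a i * ρ i z) =
      ∑ i ∈ s, a i * empiricalError μ x T (ρ i) := by
  simp only [empiricalError]
  rw [integral_finsetSum s fun i _ => (hρ i).const_mul (a i), Finset.sum_comm]
  simp only [integral_const_mul, mul_sub, Finset.sum_sub_distrib, ← Finset.mul_sum]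
  rw [Finset.mul_sum]
  congr 1
  exact Finset.sum_congr rfl fun i _ => mul_left_comm _ _ _

lemma abs_empiricalError_le [IsProbabilityMeasure μ] {S : Set X} (hμ : ∀ᵐ z ∂μ, z ∈ S)
    (hx : ∀ t, x t ∈ S) {f : X → ℝ} {ε : ℝ} (hf : ∀ z ∈ S, |f z| ≤ ε) (T : ℕ) :
    |empiricalError μ x T f| ≤ 2 * ε := by
  have hε : 0 ≤ ε := (abs_nonneg _).trans (hf _ (hx 0))
  have h_int : |∫ ω, f ω ∂μ| ≤ ε := by
    simpa using norm_integral_le_of_norm_le_const (hμ.mono fun z hz => (Real.norm_eq_abs _).trans_le (hf z hz))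
  have h_avg : |(1 / (T : ℝ)) * ∑ t ∈ Finset.range T, f (x t)| ≤ ε := by
    have h_sum : |∑ t ∈ Finset.range T, f (x t)| ≤ T * ε := by
      refine (Finset.abs_sum_le_sum_abs _ _).trans ?_
      simpa using Finset.sum_le_sum fun t (_ : t ∈ Finset.range T) => hf _ (hx t)
    rw [abs_mul, abs_of_nonneg (by positivity : (0 : ℝ) ≤ 1 / T), one_div_mul_eq_div]
    exact div_le_of_le_mul₀ (by positivity) hε (by linarith)
  calc |empiricalError μ x T f| ≤ _ := abs_sub _ _
    _ ≤ 2 * ε := by linarith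

/-- On a compact set, empirical averages that converge for every continuous function converge
uniformly over bounded uniformly equicontinuous families. -/
theorem tendsto_empiricalError_of_uniformEquicontinuous [MetricSpace X]
    [OpensMeasurableSpace X] [IsProbabilityMeasure μ] {S : Set X}
    (hS : IsCompact S) (hμ : ∀ᵐ z ∂μ, z ∈ S) (hx : ∀ t, x t ∈ S)
    (h : ∀ f : X → ℝ, Continuous f → Tendsto (fun T => empiricalError μ x T f) atTop (𝓝 0))
    {G : ℕ → X → ℝ} (hG : UniformEquicontinuous G) {M : ℝ} (hM : ∀ T z, |G T z| ≤ M) :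
    Tendsto (fun T => empiricalError μ x T (G T)) atTop (𝓝 0) := by
  rw [Metric.tendsto_nhds]
  intro ε hε
  obtain ⟨δ, hδ, hGδ⟩ := Metric.uniformEquicontinuous_iff.1 hG (ε / 4) (by positivity)
  obtain ⟨c, -, hc, hcover⟩ := hS.finite_cover_balls hδ
  have := hc.fintype
  obtain ⟨ρ, hρ⟩ := PartitionOfUnity.exists_isSubordinate hS.isClosed
    (fun i : c => Metric.ball (i : X) δ) (fun _ => Metric.isOpen_ball) (by
      simpa [Set.iUnion_subtype] using hcover)
  have hρ_int : ∀ i, Integrable (ρ i) μ := fun i =>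
    Integrable.of_bound (ρ i).continuous.aestronglyMeasurable 1 (.of_forall fun z => by
      rw [Real.norm_of_nonneg (ρ.nonneg i z)]
      exact ρ.le_one i z)
  have hG_int : ∀ T, Integrable (G T) μ := fun T =>
    Integrable.of_bound (hG.uniformContinuous T).continuous.aestronglyMeasurable M
      (.of_forall (hM T))
  have h_approx : ∀ T, ∀ z ∈ S, |G T z - ∑ i : c, G T i * ρ i z| ≤ ε / 4 := by
    intro T z hz
    have h_one : ∑ i, ρ i z = 1 := by
      rw [← finsum_eq_sum_of_fintype]
      exact ρ.sum_eq_one hz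
    have h_eq : G T z - ∑ i : c, G T i * ρ i z = ∑ i : c, (G T z - G T i) * ρ i z := by
      simp only [sub_mul, Finset.sum_sub_distrib, ← Finset.mul_sum, h_one, mul_one]
    rw [h_eq]
    calc |∑ i : c, (G T z - G T i) * ρ i z| ≤ ∑ i : c, |(G T z - G T i) * ρ i z| :=
          Finset.abs_sum_le_sum_abs _ _
      _ ≤ ∑ i : c, ε / 4 * ρ i z := by
          refine Finset.sum_le_sum fun i _ => ?_
          rw [abs_mul, abs_of_nonneg (ρ.nonneg i z)]
          by_cases hzi : ρ i z = 0
          · simp [hzi]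
          · have hz_ball : dist z i < δ := hρ i (subset_tsupport _ hzi)
            exact mul_le_mul_of_nonneg_right (hGδ z i hz_ball T).le (ρ.nonneg i z)
      _ = ε / 4 := by rw [← Finset.mul_sum, h_one, mul_one]
  have h_lim : Tendsto (fun T => ∑ i, M * |empiricalError μ x T (ρ i)|) atTop (𝓝 0) := by
    simpa using tendsto_finsetSum Finset.univ fun i _ =>
      ((h (ρ i) (ρ i).continuous).abs.const_mul M)
  filter_upwards [h_lim.eventually_lt_const (half_pos hε)] with T hT
  have h_int : Integrable (fun z => ∑ i : c, G T i * ρ i z) μ :=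
    integrable_finsetSum _ fun i _ => (hρ_int i).const_mul _
  have h_split : empiricalError μ x T (G T) =
      empiricalError μ x T (fun z => G T z - ∑ i : c, G T i * ρ i z) +
        ∑ i : c, G T i * empiricalError μ x T (ρ i) := by
    rw [← empiricalError_sum_mul _ _ hρ_int,
      empiricalError_sub (hG_int T) h_int, sub_add_cancel]
  have h_fst := abs_empiricalError_le hμ hx (h_approx T) T
  have h_snd : |∑ i : c, G T i * empiricalError μ x T (ρ i)| ≤
      ∑ i, M * |empiricalError μ x T (ρ i)| := by
    refine (Finset.abs_sum_le_sum_abs _ _).trans (Finset.sum_le_sum fun i _ => ?_)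
    rw [abs_mul]
    exact mul_le_mul_of_nonneg_right (hM T i) (abs_nonneg _)
  rw [dist_zero_right, Real.norm_eq_abs, h_split]
  exact (abs_add_le _ _).trans_lt (by linarith)

end EmpiricalError

theorem backward_ergodic_implies_forward_ergodic
    (n : ℕ)
    (Ω₀ : Set (EuclideanSpace ℝ (Fin n)))
    (hΩ₀ : IsCompact Ω₀)
    (μ₀ : Measure (EuclideanSpace ℝ (Fin n)))
    [IsProbabilityMeasure μ₀]
    (hsupp : {x : EuclideanSpace ℝ (Fin n) |
        ∀ U : Set (EuclideanSpace ℝ (Fin n)), IsOpen U → x ∈ U → 0 < μ₀ U} ⊆ Ω₀)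
    (ζ : ℕ → (EuclideanSpace ℝ (Fin n) ≃ₜ EuclideanSpace ℝ (Fin n)))
    (hζ0 : ζ 0 = Homeomorph.refl (EuclideanSpace ℝ (Fin n)))
    (hζadd : ∀ s t : ℕ, ∀ x : EuclideanSpace ℝ (Fin n), ζ s (ζ t x) = ζ (s + t) x)
    (hLip : ∀ t : ℕ, LipschitzWith 1 (ζ t))
    (K : Set (EuclideanSpace ℝ (Fin n)))
    (hK : IsCompact K)
    (hKΩ : ∀ t : ℕ, (ζ t) '' Ω₀ ⊆ K)
    (y : ℕ → EuclideanSpace ℝ (Fin n))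
    (hy : ∀ t : ℕ, (ζ t).symm (y t) ∈ Ω₀)
    (hyp : (∀ φ : EuclideanSpace ℝ (Fin n) → ℝ, Continuous φ →
      Tendsto (fun T : ℕ =>
          (1 / (T : ℝ)) * ∑ t ∈ Finset.range T, φ ((ζ t).symm (y t)))
        atTop (𝓝 (∫ ω, φ ω ∂μ₀)))) :
    (∀ φ : EuclideanSpace ℝ (Fin n) → ℝ, Continuous φ → HasCompactSupport φ →
      Tendsto (fun T : ℕ =>
          (1 / (T : ℝ)) * ∑ t ∈ Finset.range T, φ (ζ (T - 1 - t) (y t))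
            - ∫ ω, φ ω ∂(μ₀.map (ζ (T - 1))))
        atTop (𝓝 0)) := by
  intro φ hφ hφc
  have hμ : ∀ᵐ z ∂μ₀, z ∈ Ω₀ := by
    filter_upwards [μ₀.support_mem_ae] with z hz
    refine hsupp fun U hU hzU => ?_
    exact (Measure.mem_support_iff_forall z).1 hz U (hU.mem_nhds hzU)
  have h_err : ∀ f : EuclideanSpace ℝ (Fin n) → ℝ, Continuous f →
      Tendsto (fun T => empiricalError μ₀ (fun t => (ζ t).symm (y t)) T f) atTop (𝓝 0) :=
    fun f hf => by simpa [empiricalError] using (hyp f hf).sub_const (∫ ω, f ω ∂μ₀)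
  have h_equi : UniformEquicontinuous fun T : ℕ => φ ∘ ζ (T - 1) := by
    rw [Metric.uniformEquicontinuous_iff]
    intro ε hε
    obtain ⟨δ, hδ, hφδ⟩ :=
      Metric.uniformContinuous_iff.1 (hφc.uniformContinuous_of_continuous hφ) ε hε
    refine ⟨δ, hδ, fun a b hab T => hφδ (lt_of_le_of_lt ?_ hab)⟩
    simpa using (hLip (T - 1)).dist_le_mul a b
  obtain ⟨M, hM⟩ := hφc.exists_bound_of_continuous hφ
  refine (tendsto_empiricalError_of_uniformEquicontinuous hΩ₀ hμ hy h_err h_equi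
    fun T z => hM (ζ (T - 1) z)).congr fun T => ?_
  rw [empiricalError, (ζ (T - 1)).measurableEmbedding.integral_map]
  congr 2
  refine Finset.sum_congr rfl fun t ht => ?_
  have ht' : T - 1 = (T - 1 - t) + t := by have := Finset.mem_range.1 ht; omega
  have h_flow := hζadd (T - 1 - t) t ((ζ t).symm (y t))
  rw [Homeomorph.apply_symm_apply, ← ht'] at h_flow
  rw [Function.comp_apply, h_flow]
end

section
/- Let ζ be a discrete flow on ℝⁿ, μ₀ a Borel probability measure on ℝⁿ, and let y, y' : ℕ → ℝⁿ be two trajectories for which there exists s₀ ∈ ℕ such that ζ s₀ (y t) = ζ s₀ (y' t) for all t ∈ ℕ. Then y is ergodic in the forward (general) sense with respect to the time-varying measures μ_t := (ζ t)_* μ₀ if and only if y' is; i.e., the forward definition of time-varying ergodicity cannot distinguish trajectories whose points are identified by the (non-injective) flow. -/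
open MeasureTheory Filter Topology

/-- Iterates of a discrete flow past time `s₀` agree on points identified at time `s₀`. -/
theorem flow_eq_of_identified {X : Type*} {ζ : ℕ → X → X}
    (hζadd : ∀ s t : ℕ, ζ s ∘ ζ t = ζ (s + t)) {s₀ s : ℕ} (hs : s₀ ≤ s) {x x' : X}
    (h : ζ s₀ x = ζ s₀ x') : ζ s x = ζ s x' := by
  obtain ⟨k, rfl⟩ := Nat.exists_eq_add_of_le' hs
  rw [← hζadd k s₀, Function.comp_apply, Function.comp_apply, h]

/-- The forward averages of a bounded observable along two trajectories identified by the flow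
are asymptotically equal. -/
theorem tendsto_forward_average_sub {X : Type*} {ζ : ℕ → X → X}
    (hζadd : ∀ s t : ℕ, ζ s ∘ ζ t = ζ (s + t)) {y y' : ℕ → X} {s₀ : ℕ}
    (hident : ∀ t : ℕ, ζ s₀ (y t) = ζ s₀ (y' t)) {φ : X → ℝ} {C : ℝ} (hC : ∀ x, ‖φ x‖ ≤ C) :
    Tendsto (fun T : ℕ =>
      (1 / (T : ℝ)) * ∑ t ∈ Finset.range T, φ (ζ (T - 1 - t) (y t))
        - (1 / (T : ℝ)) * ∑ t ∈ Finset.range T, φ (ζ (T - 1 - t) (y' t))) atTop (𝓝 0) := by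
  have hlim : Tendsto (fun T : ℕ => (s₀ * (C + C)) / (T : ℝ)) atTop (𝓝 0) :=
    tendsto_const_div_atTop_nhds_zero_nat _
  refine squeeze_zero_norm (fun T => ?_) hlim
  rw [← mul_sub, ← Finset.sum_sub_distrib, norm_mul, Real.norm_of_nonneg (by positivity),
    one_div_mul_eq_div]
  gcongr
  rw [← Finset.sum_range_reflect]
  have hterm : ∀ j ∈ Finset.range T,
      ‖φ (ζ (T - 1 - (T - 1 - j)) (y (T - 1 - j))) - φ (ζ (T - 1 - (T - 1 - j)) (y' (T - 1 - j)))‖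
        ≤ if j < s₀ then C + C else 0 := by
    intro j hj
    split_ifs with hjs
    · exact (norm_sub_le _ _).trans (add_le_add (hC _) (hC _))
    · have hle : s₀ ≤ T - 1 - (T - 1 - j) := by
        rw [Finset.mem_range] at hj
        omega
      rw [flow_eq_of_identified hζadd hle (hident _), sub_self, norm_zero]
  refine (norm_sum_le_of_le _ hterm).trans ?_
  have hcard : ((Finset.range T).filter (· < s₀)).card ≤ s₀ := by
    calc _ ≤ (Finset.range s₀).card := Finset.card_le_card fun j hj => by simp_all
      _ = s₀ := Finset.card_range s₀
  have hC0 : 0 ≤ C + C := by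
    have := (norm_nonneg _).trans (hC (y 0))
    positivity
  rw [← Finset.sum_filter, Finset.sum_const, nsmul_eq_mul]
  gcongr

/-- The forward (general) definition of time-varying ergodicity cannot distinguish
two trajectories whose points are identified by the (possibly non-injective) flow:
if `ζ s₀ (y t) = ζ s₀ (y' t)` for all `t`, then `y` is forward ergodic with respect to
the time-varying measures `μ_t := (ζ t)_* μ₀` iff `y'` is. -/
theorem forward_ergodic_iff_of_flow_identified
    (n : ℕ)
    (ζ : ℕ → EuclideanSpace ℝ (Fin n) → EuclideanSpace ℝ (Fin n))
    (hcont : ∀ t : ℕ, Continuous (ζ t))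
    (hζ0 : ζ 0 = id)
    (hζadd : ∀ s t : ℕ, ζ s ∘ ζ t = ζ (s + t))
    (μ₀ : Measure (EuclideanSpace ℝ (Fin n)))
    [IsProbabilityMeasure μ₀]
    (y y' : ℕ → EuclideanSpace ℝ (Fin n))
    (s₀ : ℕ)
    (hident : ∀ t : ℕ, ζ s₀ (y t) = ζ s₀ (y' t)) :
    (∀ φ : EuclideanSpace ℝ (Fin n) → ℝ, Continuous φ → HasCompactSupport φ →
      Tendsto (fun T : ℕ =>
          (1 / (T : ℝ)) * ∑ t ∈ Finset.range T, φ (ζ (T - 1 - t) (y t))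
            - ∫ ω, φ ω ∂(μ₀.map (ζ (T - 1))))
        atTop (𝓝 0))
    ↔
    (∀ φ : EuclideanSpace ℝ (Fin n) → ℝ, Continuous φ → HasCompactSupport φ →
      Tendsto (fun T : ℕ =>
          (1 / (T : ℝ)) * ∑ t ∈ Finset.range T, φ (ζ (T - 1 - t) (y' t))
            - ∫ ω, φ ω ∂(μ₀.map (ζ (T - 1))))
        atTop (𝓝 0)) := by
  have key : ∀ φ : EuclideanSpace ℝ (Fin n) → ℝ, Continuous φ → HasCompactSupport φ →
      Tendsto (fun T : ℕ =>
        (1 / (T : ℝ)) * ∑ t ∈ Finset.range T, φ (ζ (T - 1 - t) (y t))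
          - (1 / (T : ℝ)) * ∑ t ∈ Finset.range T, φ (ζ (T - 1 - t) (y' t))) atTop (𝓝 0) := by
    intro φ hφ hsupp
    obtain ⟨C, hC⟩ := hφ.bounded_above_of_compact_support hsupp
    exact tendsto_forward_average_sub hζadd hident hC
  refine forall_congr' fun φ => forall_congr' fun hφ => forall_congr' fun hsupp => ?_
  constructor <;> intro h
  · simpa using h.sub (key φ hφ hsupp)
  · simpa using h.add (key φ hφ hsupp)
end
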